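/- arXiv:1105.2599 — 2 statements merged into one kernel-verified Lean document; each statement's English description precedes it below -/
import Mathlib

section
/- Let b ≥ 2 and α ≥ 2 be integers and let x ∈ [0,1) with base-b digits ξ_1, ξ_2, …. Set σ = ∑_{i ≥ 1 : ξ_i ≠ 0} b^{−i} and σ₂ = ∑_{i ≥ 1 : ξ_i ≠ 0} b^{−2i}. Then the sum of r_α(k) wal_k(x) over all integers k ≥ 1 having exactly two non-zero base-b digits converges absolutely and equals s_2(x) := 1/(b+1) − b(b−2)·(σ² − σ₂)/2 − b(b−1)·(1/(b−1) − σ)·σ. -/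
open scoped BigOperators
open scoped Classical

noncomputable section

/-- The `i`-th base-`b` digit (for `i ≥ 1`) of a real `x` (intended `x ∈ [0,1)`),
using the expansion that does not end in infinitely many digits `b-1`. -/
def xdigit (b : ℕ) (x : ℝ) (i : ℕ) : ℕ := (⌊x * (b : ℝ) ^ i⌋).toNat % b

/-- The `i`-th base-`b` digit of a natural number `k`. -/
def ndigit (b k i : ℕ) : ℕ := k / b ^ i % b

/-- The `k`-th Walsh function in base `b`:
`wal_k(x) = exp(2πi (ξ_1 κ_0 + ξ_2 κ_1 + ⋯)/b)`. -/
def wal (b k : ℕ) (x : ℝ) : ℂ :=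
  Complex.exp (2 * (Real.pi : ℂ) * Complex.I / (b : ℂ) *
    ∑ i ∈ Finset.range (k + 1), (ndigit b k i : ℂ) * (xdigit b x (i + 1) : ℂ))

/-- The set of positions of nonzero base-`b` digits of `k`. -/
def nzset (b k : ℕ) : Finset ℕ :=
  (Finset.range (k + 1)).filter fun i => ndigit b k i ≠ 0

/-- The (at most) `α` largest nonzero-digit positions of `k` in base `b`. -/
def topPos (b α k : ℕ) : Finset ℕ :=
  (nzset b k).filter fun a => ((nzset b k).filter fun y => a < y).card < α

/-- `r_α(k) = b^{-∑_{i=1}^{min(#k,α)} (a_i + 1)}`, where `a_1 > a_2 > ⋯` are the positions of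
the nonzero base-`b` digits of `k`; `r_α(0) = 1`. -/
def ralpha (b α k : ℕ) : ℝ := ((b : ℝ) ^ (∑ a ∈ topPos b α k, (a + 1)))⁻¹

/-- `r_α(γ, k) = ∏_{j : k_j ≠ 0} γ_j r_α(k_j)` (weights indexed from `0`). -/
def rvec (b α : ℕ) (γ : ℕ → ℝ) {s : ℕ} (k : Fin s → ℕ) : ℝ :=
  ∏ j, if k j = 0 then 1 else γ (j : ℕ) * ralpha b α (k j)

/-- `ω_α(x) = ∑_{k=1}^∞ r_α(k) wal_k(x)`. -/
def omegaF (b α : ℕ) (x : ℝ) : ℂ :=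
  ∑' k : ℕ, (ralpha b α (k + 1) : ℂ) * wal b (k + 1) x

/-- `σ(x) = ∑_{i ≥ 1 : ξ_i ≠ 0} b^{-i}`, the sum of `b^{-i}` over the positions of the
nonzero base-`b` digits of `x`. -/
def sigma1 (b : ℕ) (x : ℝ) : ℝ :=
  ∑' i : ℕ, if xdigit b x (i + 1) ≠ 0 then ((b : ℝ) ^ (i + 1))⁻¹ else 0

/-- `σ₂(x) = ∑_{i ≥ 1 : ξ_i ≠ 0} b^{-2i}`. -/
def sigma2 (b : ℕ) (x : ℝ) : ℝ :=
  ∑' i : ℕ, if xdigit b x (i + 1) ≠ 0 then ((b : ℝ) ^ (2 * (i + 1)))⁻¹ else 0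

/-- `s_1(x) = 1 - b σ(x)`. -/
def s1f (b : ℕ) (x : ℝ) : ℝ := 1 - (b : ℝ) * sigma1 b x

/-- `s_2(x) = 1/(b+1) - b(b-2)(σ(x)² - σ₂(x))/2 - b(b-1)(1/(b-1) - σ(x))σ(x)`. -/
def s2f (b : ℕ) (x : ℝ) : ℝ :=
  1 / ((b : ℝ) + 1) -
    (b : ℝ) * ((b : ℝ) - 2) * ((sigma1 b x) ^ 2 - sigma2 b x) / 2 -
    (b : ℝ) * ((b : ℝ) - 1) * (1 / ((b : ℝ) - 1) - sigma1 b x) * sigma1 b x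

/-- `a_1(x)`: the position of the first nonzero base-`b` digit of `x` (junk value for `x = 0`). -/
def firstIdx (b : ℕ) (x : ℝ) : ℕ := sInf {i | xdigit b x i ≠ 0}

/-! ### Base-`b` digits of natural numbers -/

lemma ndigit_lt {b : ℕ} (hb : 2 ≤ b) (k m : ℕ) : ndigit b k m < b :=
  Nat.mod_lt _ (by omega)

lemma ndigit_eq_zero_of_lt {b k m : ℕ} (h : k < b ^ m) : ndigit b k m = 0 := by
  simp [ndigit, Nat.div_eq_of_lt h]

lemma mod_pow_eq_sum_ndigit (b k n : ℕ) :
    k % b ^ n = ∑ m ∈ Finset.range n, ndigit b k m * b ^ m := by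
  induction n with
  | zero => simp [Nat.mod_one]
  | succ n ih => rw [Finset.sum_range_succ, ← ih, Nat.mod_pow_succ, ndigit, mul_comm (b ^ n)]

lemma mem_nzset {b : ℕ} (hb : 2 ≤ b) {k m : ℕ} : m ∈ nzset b k ↔ ndigit b k m ≠ 0 := by
  simp only [nzset, Finset.mem_filter, Finset.mem_range, and_iff_right_iff_imp]
  intro h
  by_contra hm
  refine h (ndigit_eq_zero_of_lt ?_)
  have : m < b ^ m := Nat.lt_pow_self (by omega)
  omega

lemma sum_nzset_ndigit {b : ℕ} (hb : 2 ≤ b) (k : ℕ) :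
    ∑ m ∈ nzset b k, ndigit b k m * b ^ m = k := by
  have hk : k < b ^ (k + 1) :=
    (Nat.lt_succ_self k).trans (Nat.lt_pow_self (by omega))
  conv_rhs => rw [← Nat.mod_eq_of_lt hk, mod_pow_eq_sum_ndigit]
  refine Finset.sum_subset (Finset.filter_subset _ _) fun m _ hm => ?_
  rw [mem_nzset hb, not_not] at hm
  simp [hm]

lemma ndigit_two_term {b i j c d : ℕ} (hij : i < j) (hc : c < b) (hd : d < b)
    (m : ℕ) : ndigit b (c * b ^ i + d * b ^ j) m = if m = i then c else if m = j then d else 0 := by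
  have hb0 : 0 < b := by omega
  have hlt : ∀ {e n}, e < b → e * b ^ n < b ^ (n + 1) := fun {e n} he => by
    rw [pow_succ']
    exact Nat.mul_lt_mul_of_pos_right he (pow_pos hb0 n)
  rcases lt_trichotomy m j with hmj | rfl | hmj
  · obtain ⟨t, rfl⟩ : ∃ t, j = m + 1 + t := ⟨j - (m + 1), by omega⟩
    have hdj : d * b ^ (m + 1 + t) = b ^ m * (b * (d * b ^ t)) := by ring
    rw [ndigit, hdj, Nat.add_mul_div_left _ _ (pow_pos hb0 m), Nat.add_mul_mod_self_left]
    rcases lt_trichotomy m i with hmi | rfl | hmi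
    · obtain ⟨s, rfl⟩ : ∃ s, i = m + 1 + s := ⟨i - (m + 1), by omega⟩
      have hci : c * b ^ (m + 1 + s) = b ^ m * (b * (c * b ^ s)) := by ring
      rw [hci, Nat.mul_div_cancel_left _ (pow_pos hb0 m), Nat.mul_mod_right,
        if_neg (by omega), if_neg (by omega)]
    · rw [Nat.mul_div_cancel _ (pow_pos hb0 m), Nat.mod_eq_of_lt hc, if_pos rfl]
    · have : c * b ^ i < b ^ m := (hlt hc).trans_le (Nat.pow_le_pow_right hb0 hmi)
      rw [Nat.div_eq_of_lt this, Nat.zero_mod, if_neg (by omega), if_neg (by omega)]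
  · have : c * b ^ i < b ^ m := (hlt hc).trans_le (Nat.pow_le_pow_right hb0 hij)
    rw [ndigit, Nat.add_mul_div_right _ _ (pow_pos hb0 m), Nat.div_eq_of_lt this, zero_add,
      Nat.mod_eq_of_lt hd, if_neg (by omega), if_pos rfl]
  · rw [if_neg (by omega), if_neg (by omega)]
    apply ndigit_eq_zero_of_lt
    have h1 : c * b ^ i < b ^ j := (hlt hc).trans_le (Nat.pow_le_pow_right hb0 hij)
    have h2 : (d + 1) * b ^ j ≤ b * b ^ j := Nat.mul_le_mul_right _ hd
    have h3 : b ^ (j + 1) ≤ b ^ m := Nat.pow_le_pow_right hb0 hmj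
    rw [pow_succ'] at h3
    linarith

lemma nzset_two_term {b i j c d : ℕ} (hb : 2 ≤ b) (hij : i < j) (hc : c < b) (hd : d < b)
    (hc0 : c ≠ 0) (hd0 : d ≠ 0) : nzset b (c * b ^ i + d * b ^ j) = {i, j} := by
  ext m
  rw [mem_nzset hb, ndigit_two_term hij hc hd, Finset.mem_insert, Finset.mem_singleton]
  split_ifs <;> simp_all

/-! ### Walsh functions and their coefficients -/

lemma topPos_eq_nzset {b α k : ℕ} (h : (nzset b k).card ≤ α) : topPos b α k = nzset b k := by
  refine Finset.filter_true_of_mem fun a ha => lt_of_lt_of_le (Finset.card_lt_card ?_) h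
  exact Finset.filter_ssubset.2 ⟨a, ha, lt_irrefl a⟩

lemma wal_eq_pow (b k : ℕ) (x : ℝ) :
    wal b k x = Complex.exp (2 * Real.pi * Complex.I / b) ^
      (∑ m ∈ nzset b k, ndigit b k m * xdigit b x (m + 1)) := by
  rw [wal, ← Complex.exp_nat_mul, mul_comm]
  congr 2
  rw [nzset, Finset.sum_filter_of_ne]
  · push_cast
    rfl
  · intro m _ h h0
    simp [h0] at h

lemma sum_root_pow {b : ℕ} (hb : 2 ≤ b) {n : ℕ} (hn : n < b) :
    ∑ c : Fin (b - 1), Complex.exp (2 * Real.pi * Complex.I / b) ^ ((c + 1 : ℕ) * n) =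
      if n ≠ 0 then -1 else (b : ℂ) - 1 := by
  have hprim := Complex.isPrimitiveRoot_exp b (by omega)
  set e := Complex.exp (2 * Real.pi * Complex.I / b)
  rw [Fin.sum_univ_eq_sum_range (fun c => e ^ ((c + 1) * n))]
  split_ifs with h
  · have hne : e ^ n ≠ 1 := hprim.pow_ne_one_of_pos_of_lt h hn
    have hgeom : ∑ c ∈ Finset.range b, (e ^ n) ^ c = 0 := by
      rw [geom_sum_eq hne, ← pow_mul, mul_comm, pow_mul, hprim.pow_eq_one]
      simp
    obtain ⟨a, rfl⟩ : ∃ a, b = a + 1 := ⟨b - 1, by omega⟩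
    rw [Finset.sum_range_succ'] at hgeom
    simp only [← pow_mul, pow_zero] at hgeom
    simp only [Nat.add_sub_cancel, mul_comm _ n]
    exact eq_neg_of_add_eq_zero_left hgeom
  · obtain rfl : n = 0 := not_not.1 h
    simp [Nat.cast_sub (show 1 ≤ b by omega)]

/-! ### Sums over ordered pairs -/

lemma HasSum.of_eq_of_eq {β : Type*} {f g : β → ℝ} {a c : ℝ} (h : HasSum f a)
    (hfg : ∀ i, g i = f i) (hac : c = a) : HasSum g c := by
  rwa [hac, funext hfg]

lemma Summable.ite_zero {β : Type*} {f : β → ℝ} (h : Summable f) (P : β → Prop)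
    [DecidablePred P] : Summable fun i => if P i then f i else 0 :=
  (h.indicator {i | P i}).congr fun i => by simp [Set.indicator_apply]

lemma hasSum_mul_of_lt {A : ℕ → ℝ} {S D : ℝ} (hS : HasSum A S) (hD : HasSum (fun i => A i ^ 2) D) :
    HasSum (fun p : ℕ × ℕ => if p.1 < p.2 then A p.1 * A p.2 else 0) ((S ^ 2 - D) / 2) := by
  have habs : Summable fun i => ‖A i‖ := hS.summable.norm
  have hprod : Summable fun p : ℕ × ℕ => A p.1 * A p.2 := summable_mul_of_summable_norm habs habs
  have htot : HasSum (fun p : ℕ × ℕ => A p.1 * A p.2) (S * S) := hS.mul hS hprod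
  have hlt : Summable fun p : ℕ × ℕ => if p.1 < p.2 then A p.1 * A p.2 else 0 :=
    hprod.ite_zero fun p => p.1 < p.2
  obtain ⟨T, hT⟩ := hlt
  have hgt : HasSum (fun p : ℕ × ℕ => if p.2 < p.1 then A p.2 * A p.1 else 0) T :=
    ((Equiv.prodComm ℕ ℕ).hasSum_iff.2 hT).of_eq_of_eq (fun _ => rfl) rfl
  have hdiag : HasSum (fun p : ℕ × ℕ => if p.1 = p.2 then A p.1 * A p.2 else 0) D := by
    have hinj : Function.Injective fun i : ℕ => (i, i) := fun i j h => (Prod.mk.inj h).1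
    refine (hinj.hasSum_iff ?_).1 (by simpa [Function.comp_def, ← pow_two] using hD)
    rintro ⟨i, j⟩ h
    refine if_neg fun hij : i = j => h ⟨i, ?_⟩
    rw [hij]
  have hall : HasSum (fun p : ℕ × ℕ => A p.1 * A p.2) (T + T + D) := by
    refine ((hT.add hgt).add hdiag).of_eq_of_eq (fun p => ?_) rfl
    rcases lt_trichotomy p.1 p.2 with h | h | h
    · simp [h, h.not_gt, h.ne]
    · simp [h]
    · simp [h, h.not_gt, h.ne', mul_comm]
  have := htot.unique hall
  exact hT.of_eq_of_eq (fun _ => rfl) (by linarith)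

/-! ### The one-digit sums -/

lemma hasSum_inv_pow_succ {q : ℝ} (hq : 1 < q) :
    HasSum (fun i : ℕ => (q ^ (i + 1))⁻¹) (1 / (q - 1)) := by
  have h := (hasSum_geometric_of_lt_one (by positivity) (inv_lt_one_of_one_lt₀ hq)).mul_right q⁻¹
  have hq1 : q - 1 ≠ 0 := by linarith
  refine h.of_eq_of_eq (fun i => ?_) ?_
  · rw [← pow_succ, inv_pow]
  · have : 1 - q⁻¹ = (q - 1) / q := by field_simp
    rw [this]
    field_simp

/-- The contribution of all one-digit indices `κ b ^ i`, `κ ∈ {1, …, b - 1}`. -/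
def digitTerm (b : ℕ) (x : ℝ) (i : ℕ) : ℝ :=
  ((b : ℝ) ^ (i + 1))⁻¹ * if xdigit b x (i + 1) ≠ 0 then -1 else (b : ℝ) - 1

lemma hasSum_digitTerm {b : ℕ} (hb : 2 ≤ b) (x : ℝ) :
    HasSum (digitTerm b x) (1 - b * sigma1 b x) := by
  have hb1 : (1 : ℝ) < b := by exact_mod_cast hb
  have hw := hasSum_inv_pow_succ hb1
  have hσ : HasSum (fun i : ℕ => if xdigit b x (i + 1) ≠ 0 then ((b : ℝ) ^ (i + 1))⁻¹ else 0)
      (sigma1 b x) := (hw.summable.ite_zero fun i => xdigit b x (i + 1) ≠ 0).hasSum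
  refine ((hw.mul_left ((b : ℝ) - 1)).sub (hσ.mul_left (b : ℝ))).of_eq_of_eq (fun i => ?_) ?_
  · rw [digitTerm]
    split_ifs <;> ring
  · have : (b : ℝ) - 1 ≠ 0 := by linarith
    field_simp

lemma hasSum_digitTerm_sq {b : ℕ} (hb : 2 ≤ b) (x : ℝ) :
    HasSum (fun i => digitTerm b x i ^ 2)
      (((b : ℝ) - 1) / (b + 1) - b * (b - 2) * sigma2 b x) := by
  have hb1 : (1 : ℝ) < b := by exact_mod_cast hb
  have hw := hasSum_inv_pow_succ (one_lt_pow₀ hb1 two_ne_zero)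
  simp only [← pow_mul] at hw
  have hσ : HasSum (fun i : ℕ => if xdigit b x (i + 1) ≠ 0 then ((b : ℝ) ^ (2 * (i + 1)))⁻¹ else 0)
      (sigma2 b x) := (hw.summable.ite_zero fun i => xdigit b x (i + 1) ≠ 0).hasSum
  refine ((hw.mul_left (((b : ℝ) - 1) ^ 2)).sub (hσ.mul_left ((b : ℝ) * (b - 2)))).of_eq_of_eq (fun i => ?_) ?_
  · rw [digitTerm, mul_pow, inv_pow, ← pow_mul, mul_comm (i + 1) 2]
    split_ifs <;> ring
  · have h1 : (b : ℝ) - 1 ≠ 0 := by linarith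
    have h2 : (b : ℝ) + 1 ≠ 0 := by linarith
    have h3 : (b : ℝ) ^ 2 - 1 = (b - 1) * (b + 1) := by ring
    rw [h3]
    field_simp

lemma hasSum_digitTerm_mul_of_lt {b : ℕ} (hb : 2 ≤ b) (x : ℝ) :
    HasSum (fun p : ℕ × ℕ => if p.1 < p.2 then digitTerm b x p.1 * digitTerm b x p.2 else 0)
      (s2f b x) := by
  have hb1 : (1 : ℝ) < b := by exact_mod_cast hb
  refine (hasSum_mul_of_lt (hasSum_digitTerm hb x) (hasSum_digitTerm_sq hb x)).of_eq_of_eq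
    (fun _ => rfl) ?_
  have h1 : (b : ℝ) - 1 ≠ 0 := by linarith
  have h2 : (b : ℝ) + 1 ≠ 0 := by linarith
  rw [s2f]
  field_simp
  ring

/-! ### Indices with two non-zero digits -/

/-- The index with digit `q.2.1 + 1` in position `q.1.1` and digit `q.2.2 + 1` in position
`q.1.2`. -/
def twoDigit (b : ℕ) (q : (ℕ × ℕ) × Fin (b - 1) × Fin (b - 1)) : ℕ :=
  (q.2.1 + 1) * b ^ q.1.1 + (q.2.2 + 1) * b ^ q.1.2

/-- The summand of index `twoDigit b q` for `q.1.1 < q.1.2`, extended by zero. -/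
def twoDigitTerm (b : ℕ) (x : ℝ) (q : (ℕ × ℕ) × Fin (b - 1) × Fin (b - 1)) : ℂ :=
  if q.1.1 < q.1.2 then
    (((b : ℂ) ^ (q.1.1 + 1))⁻¹ *
        Complex.exp (2 * Real.pi * Complex.I / b) ^ ((q.2.1 + 1 : ℕ) * xdigit b x (q.1.1 + 1))) *
      (((b : ℂ) ^ (q.1.2 + 1))⁻¹ *
        Complex.exp (2 * Real.pi * Complex.I / b) ^ ((q.2.2 + 1 : ℕ) * xdigit b x (q.1.2 + 1)))
  else 0

lemma summable_twoDigitTerm {b : ℕ} (hb : 2 ≤ b) (x : ℝ) : Summable (twoDigitTerm b x) := by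
  have hb1 : (1 : ℝ) < b := by exact_mod_cast hb
  have hw := (hasSum_inv_pow_succ hb1).summable
  have hw0 : 0 ≤ fun i : ℕ => ((b : ℝ) ^ (i + 1))⁻¹ := fun i => by positivity
  have hpair := hw.mul_of_nonneg hw hw0 hw0
  have hone : Summable fun _ : Fin (b - 1) × Fin (b - 1) => (1 : ℝ) := Summable.of_finite
  refine Summable.of_norm_bounded
    (hpair.mul_of_nonneg hone (fun p => by positivity) fun _ => zero_le_one) fun q => ?_
  have hnorm := (Complex.isPrimitiveRoot_exp b (by omega)).norm'_eq_one (by omega)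
  rw [twoDigitTerm]
  split_ifs
  · simp only [norm_mul, norm_inv, norm_pow, hnorm, Complex.norm_natCast, one_pow, mul_one]
    exact le_rfl
  · rw [norm_zero]
    positivity

lemma hasSum_twoDigitTerm {b : ℕ} (hb : 2 ≤ b) (x : ℝ) :
    HasSum (twoDigitTerm b x) (s2f b x : ℂ) := by
  obtain ⟨T, hT⟩ := summable_twoDigitTerm hb x
  have hfib := hT.prod_fiberwise fun p => hasSum_fintype _
  have hreal := Complex.hasSum_ofReal.2 (hasSum_digitTerm_mul_of_lt hb x)
  have hx : ∀ i, xdigit b x i < b := fun i => Nat.mod_lt _ (by omega)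
  convert hT using 1
  refine hreal.unique ?_
  convert hfib using 2 with p
  simp only [twoDigitTerm]
  split_ifs
  · rw [Fintype.sum_prod_type]
    dsimp only
    rw [← Fintype.sum_mul_sum, ← Finset.mul_sum, ← Finset.mul_sum,
      sum_root_pow hb (hx _), sum_root_pow hb (hx _), digitTerm, digitTerm]
    push_cast
    split_ifs <;> push_cast <;> rfl
  · simp

lemma twoDigit_summand {b α : ℕ} (hb : 2 ≤ b) (hα : 2 ≤ α) (x : ℝ)
    {q : (ℕ × ℕ) × Fin (b - 1) × Fin (b - 1)} (hq : q.1.1 < q.1.2) :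
    (if (nzset b (twoDigit b q)).card = 2 then
      (ralpha b α (twoDigit b q) : ℂ) * wal b (twoDigit b q) x else 0) = twoDigitTerm b x q := by
  obtain ⟨⟨i, j⟩, c, d⟩ := q
  simp only at hq
  have hc : (c : ℕ) + 1 < b := by omega
  have hd : (d : ℕ) + 1 < b := by omega
  have hnz : nzset b (twoDigit b ((i, j), c, d)) = {i, j} :=
    nzset_two_term hb hq hc hd (by omega) (by omega)
  have hcard : (nzset b (twoDigit b ((i, j), c, d))).card = 2 := by
    rw [hnz, Finset.card_pair hq.ne]
  have hdig := ndigit_two_term hq hc hd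
  rw [if_pos hcard, ralpha, topPos_eq_nzset (hcard.trans_le hα), wal_eq_pow, hnz,
    Finset.sum_pair hq.ne, Finset.sum_pair hq.ne]
  simp only [twoDigit, twoDigitTerm, hdig, hq, hq.ne', if_true, if_false]
  push_cast
  rw [pow_add, pow_add, mul_inv]
  ring

lemma twoDigit_injOn {b : ℕ} (hb : 2 ≤ b) :
    Set.InjOn (twoDigit b) {q | q.1.1 < q.1.2} := by
  rintro ⟨⟨i, j⟩, c, d⟩ hq ⟨⟨i', j'⟩, c', d'⟩ hq' h
  change i < j at hq
  change i' < j' at hq'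
  have hdig := ndigit_two_term hq (show (c : ℕ) + 1 < b by omega) (show (d : ℕ) + 1 < b by omega)
  have hdig' :=
    ndigit_two_term hq' (show (c' : ℕ) + 1 < b by omega) (show (d' : ℕ) + 1 < b by omega)
  simp only [twoDigit] at h
  rw [h] at hdig
  have key := fun m => (hdig m).symm.trans (hdig' m)
  have hi := key i
  have hj := key j
  have hi' := key i'
  have hj' := key j'
  simp only [Prod.mk.injEq, Fin.ext_iff]
  grind

lemma exists_twoDigit_eq {b : ℕ} (hb : 2 ≤ b) {k : ℕ} (hk : (nzset b k).card = 2) :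
    ∃ q, q.1.1 < q.1.2 ∧ twoDigit b q = k := by
  obtain ⟨i, j, hij, hnz⟩ : ∃ i j, i < j ∧ nzset b k = {i, j} := by
    obtain ⟨i, j, hne, hnz⟩ := Finset.card_eq_two.1 hk
    rcases hne.lt_or_gt with h | h
    · exact ⟨i, j, h, hnz⟩
    · exact ⟨j, i, h, hnz.trans (Finset.pair_comm i j)⟩
  have hi : ndigit b k i ≠ 0 := (mem_nzset hb).1 (by simp [hnz])
  have hj : ndigit b k j ≠ 0 := (mem_nzset hb).1 (by simp [hnz])
  have hib := ndigit_lt hb k i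
  have hjb := ndigit_lt hb k j
  refine ⟨((i, j), ⟨ndigit b k i - 1, by omega⟩, ⟨ndigit b k j - 1, by omega⟩), hij, ?_⟩
  have hsum := sum_nzset_ndigit hb k
  rw [hnz, Finset.sum_pair hij.ne] at hsum
  simp only [twoDigit]
  rw [Nat.sub_add_cancel (by omega), Nat.sub_add_cancel (by omega), hsum]

/-- The sum of `r_α(k) wal_k(x)` over all `k ≥ 1` with exactly two nonzero base-`b` digits
converges (absolutely) to
`s_2(x) = 1/(b+1) - b(b-2)(σ² - σ₂)/2 - b(b-1)(1/(b-1) - σ)σ`. -/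
theorem stmt9 (b α : ℕ) (hb : 2 ≤ b) (hα : 2 ≤ α) (x : ℝ) (hx0 : 0 ≤ x) (hx1 : x < 1) :
    HasSum
      (fun k : ℕ => if (nzset b k).card = 2 then (ralpha b α k : ℂ) * wal b k x else 0)
      ((s2f b x : ℝ) : ℂ) := by
  have hlt : ∀ q : Function.support (twoDigitTerm b x), q.1.1.1 < q.1.1.2 := fun q => by
    by_contra h
    exact q.2 (if_neg h)
  refine (hasSum_iff_hasSum_of_ne_zero_bij (fun q => twoDigit b q.1) ?_ ?_ ?_).2
    (hasSum_twoDigitTerm hb x)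
  · intro q q' h
    exact Subtype.ext (twoDigit_injOn hb (hlt q) (hlt q') h)
  · intro k hk
    have hcard : (nzset b k).card = 2 := by
      by_contra h
      exact hk (if_neg h)
    obtain ⟨q, hq, rfl⟩ := exists_twoDigit_eq hb hcard
    refine ⟨⟨q, ?_⟩, rfl⟩
    rw [Function.mem_support, ← twoDigit_summand hb hα x hq]
    exact hk
  · exact fun q => twoDigit_summand hb hα x (hlt q)
end
end

section
/- In base b = 2, for every x ∈ [0,1) the following exact formula holds: ω_2(x) = (1 − 2x) + (1 − 5t_1)/2 + (2 − a_1)x, where for 0 < x < 1, a_1 = −⌊log_2 x⌋ and t_1 = 2^{−a_1}, and for x = 0, a_1 = 0 and t_1 = 0 (so that ω_2(0) = 3/2). -/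
open scoped BigOperators
open scoped Classical

noncomputable section

/-- `a_1 = -⌊log_2 x⌋` for `0 < x < 1`, and `a_1 = 0` for `x = 0`. -/
def a1Int (x : ℝ) : ℤ := if x = 0 then 0 else -⌊Real.logb 2 x⌋

/-- `t_1 = 2^{-a_1}` for `0 < x < 1`, and `t_1 = 0` for `x = 0`. -/
def t1R (x : ℝ) : ℝ := if x = 0 then 0 else (2 : ℝ) ^ (-(a1Int x))

lemma ndigit_two_ne_zero_iff (k i : ℕ) : ndigit 2 k i ≠ 0 ↔ k.testBit i = true := by
  rw [Nat.testBit_eq_decide_div_mod_eq, ndigit, decide_eq_true_iff]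
  omega

lemma mem_nzset_two {k i : ℕ} : i ∈ nzset 2 k ↔ k.testBit i = true := by
  rw [nzset, Finset.mem_filter, ndigit_two_ne_zero_iff, Finset.mem_range]
  refine ⟨fun h => h.2, fun h => ⟨?_, h⟩⟩
  have h1 := Nat.ge_two_pow_of_testBit h
  have h2 := i.lt_two_pow_self
  omega

lemma lt_of_mem_nzset_two {n l i : ℕ} (hl : l < 2 ^ n) (hi : i ∈ nzset 2 l) : i < n :=
  (Nat.pow_lt_pow_iff_right one_lt_two).1
    ((Nat.ge_two_pow_of_testBit (mem_nzset_two.1 hi)).trans_lt hl)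

lemma nzset_two_pow_add {n l : ℕ} (hl : l < 2 ^ n) :
    nzset 2 (2 ^ n + l) = insert n (nzset 2 l) := by
  ext i
  rw [Finset.mem_insert, mem_nzset_two, mem_nzset_two]
  rcases lt_trichotomy i n with h | rfl | h
  · simp [Nat.testBit_two_pow_add_gt h, h.ne]
  · simp [Nat.testBit_two_pow_add_eq, Nat.testBit_lt_two_pow hl]
  · have h1 : 2 ^ (n + 1) ≤ 2 ^ i := Nat.pow_le_pow_right two_pos h
    rw [pow_succ] at h1
    simp [Nat.testBit_lt_two_pow (show 2 ^ n + l < 2 ^ i by omega),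
      Nat.testBit_lt_two_pow (show l < 2 ^ i by omega), h.ne']

lemma topPos_two_pow_add {n l : ℕ} (α : ℕ) (hl : l < 2 ^ n) :
    topPos 2 (α + 1) (2 ^ n + l) = insert n (topPos 2 α l) := by
  have hlt : ∀ i ∈ nzset 2 l, i < n := fun i hi => lt_of_mem_nzset_two hl hi
  rw [topPos, topPos, nzset_two_pow_add hl]
  have hn : (Finset.filter (fun y => n < y) (insert n (nzset 2 l))).card = 0 := by
    rw [Finset.card_eq_zero, Finset.filter_eq_empty_iff]
    intro y hy
    rcases Finset.mem_insert.1 hy with rfl | hy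
    · exact lt_irrefl _
    · exact (hlt y hy).not_gt
  rw [Finset.filter_insert, if_pos (by rw [hn]; omega)]
  congr 1
  refine Finset.filter_congr fun i hi => ?_
  rw [Finset.filter_insert, if_pos (hlt i hi), Finset.card_insert_of_notMem, add_lt_add_iff_right]
  exact fun h => (hlt n (Finset.mem_filter.1 h).1).false

lemma ralpha_zero_right (b k : ℕ) : ralpha b 0 k = 1 := by
  simp [ralpha, topPos]

lemma ralpha_two_pow_add {n l : ℕ} (α : ℕ) (hl : l < 2 ^ n) :
    ralpha 2 (α + 1) (2 ^ n + l) = (2 ^ (n + 1))⁻¹ * ralpha 2 α l := by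
  rw [ralpha, ralpha, topPos_two_pow_add α hl, Finset.sum_insert, pow_add, mul_inv]
  · norm_num
  · exact fun h => (lt_of_mem_nzset_two hl (Finset.mem_filter.1 h).1).false

lemma nzset_two_zero : nzset 2 0 = ∅ := by
  ext i
  simp [mem_nzset_two]

lemma ralpha_two_apply_zero (α : ℕ) : ralpha 2 α 0 = 1 := by
  simp [ralpha, topPos, nzset_two_zero]

lemma ralpha_nonneg (b α k : ℕ) : 0 ≤ ralpha b α k := by
  unfold ralpha
  positivity

/-- The sum of `r_α(k) ∏ s_i` over `k < 2 ^ N`, where `i` runs over the positions of the binary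
digits `1` of `k`. -/
def dyadicSum (α : ℕ) (s : ℕ → ℝ) (N : ℕ) : ℝ :=
  ∑ k ∈ Finset.range (2 ^ N), ralpha 2 α k * ∏ i ∈ nzset 2 k, s i

lemma prod_nzset_two_pow_add {n l : ℕ} (s : ℕ → ℝ) (hl : l < 2 ^ n) :
    ∏ i ∈ nzset 2 (2 ^ n + l), s i = s n * ∏ i ∈ nzset 2 l, s i := by
  rw [nzset_two_pow_add hl, Finset.prod_insert]
  exact fun h => (lt_of_mem_nzset_two hl h).false

lemma dyadicSum_zero (α : ℕ) (s : ℕ → ℝ) : dyadicSum α s 0 = 1 := by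
  simp [dyadicSum, ralpha_two_apply_zero, nzset_two_zero]

lemma dyadicSum_zero_succ (s : ℕ → ℝ) (N : ℕ) :
    dyadicSum 0 s (N + 1) = (1 + s N) * dyadicSum 0 s N := by
  unfold dyadicSum
  rw [pow_succ, mul_two, Finset.sum_range_add, add_mul, one_mul, Finset.mul_sum]
  congr 1
  refine Finset.sum_congr rfl fun l hl => ?_
  rw [prod_nzset_two_pow_add s (Finset.mem_range.1 hl), ralpha_zero_right, ralpha_zero_right]
  ring

lemma dyadicSum_succ_succ (α : ℕ) (s : ℕ → ℝ) (N : ℕ) :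
    dyadicSum (α + 1) s (N + 1) =
      dyadicSum (α + 1) s N + (2 ^ (N + 1))⁻¹ * s N * dyadicSum α s N := by
  unfold dyadicSum
  rw [pow_succ 2 N, mul_two, Finset.sum_range_add, Finset.mul_sum]
  congr 1
  refine Finset.sum_congr rfl fun l hl => ?_
  rw [prod_nzset_two_pow_add s (Finset.mem_range.1 hl),
    ralpha_two_pow_add α (Finset.mem_range.1 hl)]
  ring

lemma dyadicSum_of_eq_one {s : ℕ → ℝ} {m : ℕ} (hs : ∀ i < m, s i = 1) {N : ℕ} (hN : N ≤ m) :
    dyadicSum 0 s N = 2 ^ N ∧ dyadicSum 1 s N = 1 + N / 2 ∧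
      dyadicSum 2 s N = 5 / 2 - (3 + N) / 2 / 2 ^ N := by
  induction N with
  | zero => norm_num [dyadicSum_zero]
  | succ N ih =>
    obtain ⟨h0, h1, h2⟩ := ih (by omega)
    rw [dyadicSum_zero_succ, dyadicSum_succ_succ, dyadicSum_succ_succ, h0, h1, h2, hs N (by omega)]
    refine ⟨by ring, ?_, ?_⟩ <;> push_cast <;> field_simp <;> ring

lemma dyadicSum_of_eq_neg_one {s : ℕ → ℝ} {m : ℕ} (hs : ∀ i < m, s i = 1) (hm : s m = -1)
    {N : ℕ} (hN : m + 1 ≤ N) :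
    dyadicSum 0 s N = 0 ∧ dyadicSum 1 s N = (m + 1) / 2 := by
  induction N, hN using Nat.le_induction with
  | base =>
    obtain ⟨h0, h1, -⟩ := dyadicSum_of_eq_one hs le_rfl
    rw [dyadicSum_zero_succ, dyadicSum_succ_succ, h0, h1, hm]
    refine ⟨by ring, ?_⟩
    field_simp
    ring
  | succ N _ ih =>
    rw [dyadicSum_zero_succ, dyadicSum_succ_succ, ih.1, ih.2]
    simp

/-- If `s` is the sign sequence `(-1)^{ξ_{i+1}}` of the digits `ξ_{i+1} = X_{i+1} - 2 X_i`, whose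
first digit `1` is `ξ_{m+1}`, then `dyadicSum 2 s` has a closed form beyond `m`. -/
lemma dyadicSum_two_of_eq_neg_one {s X : ℕ → ℝ} {m : ℕ} (hs : ∀ i < m, s i = 1) (hm : s m = -1)
    (hX : ∀ i, s i = 1 - 2 * (X (i + 1) - 2 * X i)) (hXm : X (m + 1) = 1)
    {N : ℕ} (hN : m + 1 ≤ N) :
    dyadicSum 2 s N = 5 / 2 - 5 / 2 * (2 ^ (m + 1))⁻¹ -
      (m + 1) / 2 * (1 / 2) ^ N - (m + 1) * (X N / 2 ^ N) := by
  induction N, hN using Nat.le_induction with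
  | base =>
    obtain ⟨-, h1, h2⟩ := dyadicSum_of_eq_one hs le_rfl
    rw [dyadicSum_succ_succ, h1, h2, hm, hXm, one_div_pow]
    field_simp
    ring
  | succ N hN ih =>
    rw [dyadicSum_succ_succ, ih, (dyadicSum_of_eq_neg_one hs hm hN).2, hX, one_div_pow, one_div_pow]
    field_simp
    ring

lemma summable_ralpha_two_two : Summable (ralpha 2 2) := by
  refine summable_of_sum_range_le (c := 5 / 2) (ralpha_nonneg 2 2) fun n => ?_
  have h : dyadicSum 2 1 n = 5 / 2 - (3 + n) / 2 / 2 ^ n :=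
    (dyadicSum_of_eq_one (fun _ _ => rfl) le_rfl).2.2
  calc ∑ i ∈ Finset.range n, ralpha 2 2 i
      ≤ ∑ i ∈ Finset.range (2 ^ n), ralpha 2 2 i :=
        Finset.sum_le_sum_of_subset_of_nonneg
          (Finset.range_mono n.lt_two_pow_self.le) fun i _ _ => ralpha_nonneg 2 2 i
    _ = dyadicSum 2 1 n := by simp [dyadicSum]
    _ ≤ 5 / 2 := by
        rw [h, sub_le_self_iff]
        positivity

/-- The sign `(-1)^{ξ_{i+1}}` of a binary digit of `x`. -/
def digitSign (x : ℝ) (i : ℕ) : ℝ := (-1) ^ xdigit 2 x (i + 1)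

lemma wal_two_eq_prod (k : ℕ) (x : ℝ) :
    wal 2 k x = ((∏ i ∈ nzset 2 k, digitSign x i : ℝ) : ℂ) := by
  have h : ∀ i, Complex.exp (2 * Real.pi * Complex.I / (2 : ℕ) *
      ((ndigit 2 k i : ℂ) * (xdigit 2 x (i + 1) : ℂ))) =
      if ndigit 2 k i ≠ 0 then (digitSign x i : ℂ) else 1 := by
    intro i
    split_ifs with h
    · have h1 : ndigit 2 k i = 1 := by
        unfold ndigit at h ⊢
        omega
      rw [h1, digitSign, Complex.ofReal_pow, Complex.ofReal_neg, Complex.ofReal_one,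
        ← Complex.exp_pi_mul_I, ← Complex.exp_nat_mul]
      congr 1
      push_cast
      ring
    · rw [not_not.1 h]
      simp
  rw [wal, Finset.mul_sum, Complex.exp_sum, Finset.prod_congr rfl fun i _ => h i,
    ← Finset.prod_filter, nzset, Complex.ofReal_prod]

lemma abs_prod_digitSign (k : ℕ) (x : ℝ) : |∏ i ∈ nzset 2 k, digitSign x i| = 1 := by
  simp [Finset.abs_prod, digitSign]

lemma omegaF_two_two_eq {x c : ℝ}
    (h : Filter.Tendsto (dyadicSum 2 (digitSign x)) Filter.atTop (nhds (c + 1))) :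
    omegaF 2 2 x = (c : ℂ) := by
  set f : ℕ → ℝ := fun k => ralpha 2 2 k * ∏ i ∈ nzset 2 k, digitSign x i with hf
  have hsum : Summable f := by
    refine Summable.of_norm_bounded summable_ralpha_two_two fun k => ?_
    rw [hf, norm_mul, Real.norm_eq_abs, Real.norm_eq_abs, abs_prod_digitSign,
      abs_of_nonneg (ralpha_nonneg 2 2 k), mul_one]
  have hlim : Filter.Tendsto (dyadicSum 2 (digitSign x)) Filter.atTop (nhds (∑' k, f k)) :=
    hsum.hasSum.tendsto_sum_nat.comp (tendsto_pow_atTop_atTop_of_one_lt one_lt_two)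
  have h0 : f 0 = 1 := by simp [hf, ralpha_two_apply_zero, nzset_two_zero]
  have hc : ∑' k, f (k + 1) = c := by
    have h1 := tendsto_nhds_unique hlim h
    rw [hsum.tsum_eq_zero_add, h0] at h1
    linarith
  rw [← hc, Complex.ofReal_tsum, omegaF]
  exact tsum_congr fun k => by rw [wal_two_eq_prod, hf, Complex.ofReal_mul]

lemma xdigit_two {x : ℝ} (i : ℕ) : xdigit 2 x i = ⌊x * 2 ^ i⌋₊ % 2 := by
  rw [xdigit, Int.floor_toNat, Nat.cast_ofNat]

lemma digitSign_eq (x : ℝ) (i : ℕ) :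
    digitSign x i = 1 - 2 * ((⌊x * 2 ^ (i + 1)⌋₊ : ℝ) - 2 * (⌊x * 2 ^ i⌋₊ : ℝ)) := by
  have h1 : ⌊x * 2 ^ i⌋₊ = ⌊x * 2 ^ (i + 1)⌋₊ / 2 := by
    rw [← Nat.floor_div_ofNat]
    congr 1
    ring
  have h2 : (⌊x * 2 ^ (i + 1)⌋₊ : ℝ) =
      2 * (⌊x * 2 ^ i⌋₊ : ℝ) + ((⌊x * 2 ^ (i + 1)⌋₊ % 2 : ℕ) : ℝ) := by
    rw [h1]
    exact_mod_cast (Nat.div_add_mod _ 2).symm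
  rw [digitSign, xdigit_two, h2]
  rcases Nat.mod_two_eq_zero_or_one ⌊x * 2 ^ (i + 1)⌋₊ with h | h <;> rw [h] <;> norm_num

/-- The leading binary digit of `x ∈ (0,1)` sits at position `m + 1 = a_1`. -/
lemma exists_a1Int_eq {x : ℝ} (hx0 : 0 < x) (hx1 : x < 1) :
    ∃ m : ℕ, a1Int x = m + 1 ∧ 1 ≤ x * 2 ^ (m + 1) ∧ x * 2 ^ m < 1 := by
  have hneg : ⌊Real.logb 2 x⌋ < 0 := by
    rw [Int.floor_lt, Int.cast_zero]
    exact Real.logb_neg one_lt_two hx0 hx1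
  obtain ⟨m, hm⟩ := Int.eq_ofNat_of_zero_le (show 0 ≤ -⌊Real.logb 2 x⌋ - 1 by omega)
  have hfl : ⌊Real.logb 2 x⌋ = -((m : ℤ) + 1) := by omega
  refine ⟨m, by rw [a1Int, if_neg hx0.ne', hfl, neg_neg], ?_, ?_⟩
  · have h := (Int.floor_eq_iff.1 hfl).1
    rw [Real.le_logb_iff_rpow_le one_lt_two hx0, Real.rpow_intCast, zpow_neg] at h
    have h' : ((2 : ℝ) ^ (m + 1))⁻¹ ≤ x := by exact_mod_cast h
    rwa [inv_le_iff_one_le_mul₀ (by positivity)] at h'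
  · have h := (Int.floor_eq_iff.1 hfl).2
    have e : (((-((m : ℤ) + 1) : ℤ) : ℝ) + 1) = ((-(m : ℤ) : ℤ) : ℝ) := by
      push_cast
      ring
    rw [e, Real.logb_lt_iff_lt_rpow one_lt_two hx0, Real.rpow_intCast, zpow_neg,
      zpow_natCast] at h
    rwa [lt_inv_comm₀ hx0 (by positivity), lt_inv_comm₀ (by positivity) hx0, ← one_div,
      lt_div_iff₀ (by positivity)] at h

/-- In base `b = 2`, for every `x ∈ [0,1)`:
`ω_2(x) = (1 - 2x) + (1 - 5t_1)/2 + (2 - a_1)x`. -/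
theorem stmt12 (x : ℝ) (hx0 : 0 ≤ x) (hx1 : x < 1) :
    omegaF 2 2 x =
      (((1 - 2 * x) + (1 - 5 * t1R x) / 2 + (2 - (a1Int x : ℝ)) * x : ℝ) : ℂ) := by
  rcases hx0.eq_or_lt with rfl | hpos
  · refine omegaF_two_two_eq ?_
    have hs (i : ℕ) : digitSign 0 i = 1 := by simp [digitSign_eq]
    have hlim : Filter.Tendsto (fun N : ℕ => (5 / 2 : ℝ) - (3 / 2 * (1 / 2) ^ N +
        1 / 2 * ((N : ℝ) * (1 / 2) ^ N))) Filter.atTop (nhds (5 / 2 - (3 / 2 * 0 + 1 / 2 * 0))) :=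
      (((tendsto_pow_atTop_nhds_zero_of_lt_one (by norm_num) (by norm_num)).const_mul _).add
        ((tendsto_self_mul_const_pow_of_lt_one (by norm_num) (by norm_num)).const_mul _)).const_sub _
    convert hlim using 2 with N
    · rw [(dyadicSum_of_eq_one (fun i _ => hs i) le_rfl).2.2, one_div_pow]
      field_simp
    · norm_num [t1R, a1Int]
  · obtain ⟨m, ha, hm1, hm2⟩ := exists_a1Int_eq hpos hx1
    have hX0 (i : ℕ) (hi : i ≤ m) : ⌊x * 2 ^ i⌋₊ = 0 := by
      rw [Nat.floor_eq_zero]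
      refine lt_of_le_of_lt ?_ hm2
      gcongr
      norm_num
    have hX1 : ⌊x * 2 ^ (m + 1)⌋₊ = 1 := by
      rw [Nat.floor_eq_iff (by positivity), pow_succ]
      rw [pow_succ] at hm1
      constructor <;> push_cast <;> linarith
    have hs (i : ℕ) (hi : i < m) : digitSign x i = 1 := by
      simp [digitSign_eq, hX0 i hi.le, hX0 (i + 1) hi]
    have hsm : digitSign x m = -1 := by
      rw [digitSign_eq, hX0 m le_rfl, hX1]
      norm_num
    have hfloor : Filter.Tendsto (fun N : ℕ => (⌊x * 2 ^ N⌋₊ : ℝ) / 2 ^ N) Filter.atTop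
        (nhds x) :=
      (tendsto_nat_floor_mul_div_atTop hx0).comp (tendsto_pow_atTop_atTop_of_one_lt one_lt_two)
    have hlim := (((tendsto_pow_atTop_nhds_zero_of_lt_one (r := (1 / 2 : ℝ)) (by norm_num)
      (by norm_num)).const_mul (((m : ℝ) + 1) / 2)).const_sub
        (5 / 2 - 5 / 2 * ((2 : ℝ) ^ (m + 1))⁻¹)).sub (hfloor.const_mul ((m : ℝ) + 1))
    have ht : t1R x = ((2 : ℝ) ^ (m + 1))⁻¹ := by
      rw [t1R, if_neg hpos.ne', ha, zpow_neg]
      norm_cast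
    refine omegaF_two_two_eq ?_
    refine (hlim.congr' ?_).trans_eq ?_
    · filter_upwards [Filter.eventually_ge_atTop (m + 1)] with N hN
      exact (dyadicSum_two_of_eq_neg_one (X := fun i => (⌊x * 2 ^ i⌋₊ : ℝ)) hs hsm
        (digitSign_eq x) (by simp [hX1]) hN).symm
    · rw [ht, ha]
      congr 1
      push_cast
      ring
end
end
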